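/- arXiv:math/0007163 — 2 statements merged into one kernel-verified Lean document; each statement's English description precedes it below -/
import Mathlib

section
/- With f(τ) = (η(τ)η(2τ))^{-8}, g_0(τ) = (f(τ/2)+f((τ+1)/2))/2, g_1(τ) = (f(τ/2)-f((τ+1)/2))/2, the following S-transformations hold: f(-1/τ) = 2⁴(g_0(τ)+g_1(τ))/τ⁸, g_0(-1/τ) = (f(τ)/2⁴ + g_0(τ) - g_1(τ))/(2τ⁸), and g_1(-1/τ) = (f(τ)/2⁴ - g_0(τ) + g_1(τ))/(2τ⁸). -/
/-- The Dedekind eta function. -/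
noncomputable def dedekindEta (t : ℂ) : ℂ :=
  Complex.exp (Real.pi * Complex.I * t / 12) *
    ∏' n : ℕ, (1 - Complex.exp (2 * Real.pi * Complex.I * (n + 1) * t))

/-- `f = (η(τ)η(2τ))^{-8}`. -/
noncomputable def fEta2 (t : ℂ) : ℂ := (dedekindEta t * dedekindEta (2 * t)) ^ (-8 : ℤ)

/-- `g₀(τ) = (f(τ/2)+f((τ+1)/2))/2`. -/
noncomputable def gZero (t : ℂ) : ℂ := (fEta2 (t / 2) + fEta2 ((t + 1) / 2)) / 2

/-- `g₁(τ) = (f(τ/2)-f((τ+1)/2))/2`. -/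
noncomputable def gOne (t : ℂ) : ℂ := (fEta2 (t / 2) - fEta2 ((t + 1) / 2)) / 2

theorem dedekindEta_eq_eta (t : ℂ) : dedekindEta t = ModularForm.eta t := by
  simp only [dedekindEta, ModularForm.eta, ModularForm.eta_q_eq_cexp, Function.Periodic.qParam]
  congr 2
  push_cast
  ring

theorem dedekindEta_neg_inv_pow_eight {t : ℂ} (ht : 0 < t.im) :
    dedekindEta (-1 / t) ^ 8 = t ^ 4 * dedekindEta t ^ 8 := by
  have sqrt_pow (z : ℂ) (hz : z ≠ 0) : Complex.sqrt z ^ 8 = z ^ 4 := by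
    rw [sqrt_eq_exp hz, ← Complex.exp_nat_mul,
      show ((8 : ℕ) : ℂ) * (Complex.log z / 2) = (4 : ℕ) * Complex.log z by push_cast; ring,
      Complex.exp_nat_mul, Complex.exp_log hz]
  have ht0 : t ≠ 0 := by rintro rfl; simp at ht
  have key : ModularForm.eta (-1 / t) =
      (Complex.sqrt Complex.I)⁻¹ * (Complex.sqrt t * ModularForm.eta t) :=
    ModularForm.eta_comp_eq_csqrt_I_inv ht
  rw [dedekindEta_eq_eta, dedekindEta_eq_eta, key, mul_pow, mul_pow, inv_pow,
    sqrt_pow _ Complex.I_ne_zero, sqrt_pow _ ht0, Complex.I_pow_four, inv_one, one_mul]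

theorem dedekindEta_add_one (t : ℂ) :
    dedekindEta (t + 1) = Complex.exp (Real.pi * Complex.I / 12) * dedekindEta t := by
  have hprod (n : ℕ) : Complex.exp (2 * Real.pi * Complex.I * (n + 1) * (t + 1)) =
      Complex.exp (2 * Real.pi * Complex.I * (n + 1) * t) := by
    rw [Complex.exp_eq_exp_iff_exists_int]
    exact ⟨n + 1, by push_cast; ring⟩
  simp only [dedekindEta, hprod]
  rw [← mul_assoc, ← Complex.exp_add]
  congr 2
  ring

theorem fEta2_eq (t : ℂ) : fEta2 t = (dedekindEta t ^ 8 * dedekindEta (2 * t) ^ 8)⁻¹ := by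
  rw [fEta2, zpow_neg, ← mul_pow]
  norm_cast

theorem fEta2_add_one (t : ℂ) : fEta2 (t + 1) = fEta2 t := by
  rw [fEta2_eq, fEta2_eq, show 2 * (t + 1) = 2 * t + 1 + 1 by ring]
  simp only [dedekindEta_add_one, mul_pow, ← Complex.exp_nat_mul]
  have h : Complex.exp ((8 : ℕ) * (Real.pi * Complex.I / 12)) ^ 3 = 1 := by
    rw [← Complex.exp_nat_mul, ← Complex.exp_two_pi_mul_I]
    congr 1
    push_cast
    ring
  congr 1
  linear_combination (dedekindEta t ^ 8 * dedekindEta (2 * t) ^ 8) * h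

theorem im_neg_inv_pos {t : ℂ} (ht : 0 < t.im) : 0 < (-1 / t).im := by
  have := UpperHalfPlane.im_inv_neg_coe_pos ⟨t, ht⟩
  simpa [neg_div, inv_neg] using this

theorem fEta2_neg_inv {t : ℂ} (ht : 0 < t.im) :
    fEta2 (-1 / t) = 2 ^ 4 * fEta2 (t / 2) / t ^ 8 := by
  have ht2 : 0 < (t / 2).im := by simpa using ht
  rw [fEta2_eq, fEta2_eq, show 2 * (-1 / t) = -1 / (t / 2) by field_simp,
    dedekindEta_neg_inv_pow_eight ht, dedekindEta_neg_inv_pow_eight ht2,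
    mul_div_cancel₀ t two_ne_zero]
  have ht0 : t ≠ 0 := by rintro rfl; simp at ht
  simp only [mul_inv, div_pow, inv_div]
  field_simp

theorem fEta2_neg_inv_two_mul {t : ℂ} (ht : 0 < t.im) :
    fEta2 (-1 / (2 * t)) = fEta2 t / (2 ^ 4 * t ^ 8) := by
  have ht0 : t ≠ 0 := by rintro rfl; simp at ht
  rw [fEta2_neg_inv (by simpa using ht), mul_div_cancel_left₀ t two_ne_zero]
  field_simp

theorem fEta2_sub_one_div_two_mul_sub_one {s : ℂ} (hs : 0 < s.im) :
    fEta2 ((s - 1) / (2 * s - 1)) = fEta2 s / (2 * s - 1) ^ 8 := by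
  have hs0 : s ≠ 0 := by rintro rfl; simp at hs
  have hd : 2 * s - 1 ≠ 0 := by
    intro h
    have := congrArg Complex.im h
    simp at this
    linarith
  have hu : 0 < (-1 / s + 2).im := by simpa using im_neg_inv_pos hs
  have hu' : -1 / s + 2 = (2 * s - 1) / s := by field_simp; ring
  have hw : (s - 1) / (2 * s - 1) = -1 / (-1 / s + 2) + 1 := by
    rw [hu', div_div_eq_mul_div, div_add_one hd]
    ring
  rw [hw, fEta2_add_one, fEta2_neg_inv hu,
    show (-1 / s + 2) / 2 = -1 / (2 * s) + 1 by field_simp,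
    fEta2_add_one, fEta2_neg_inv_two_mul hs, hu']
  field_simp

theorem stmt6 (τ : ℂ) (hτ : 0 < τ.im) :
    fEta2 (-1 / τ) = 2 ^ 4 * (gZero τ + gOne τ) / τ ^ 8 ∧
    gZero (-1 / τ) = (fEta2 τ / 2 ^ 4 + gZero τ - gOne τ) / (2 * τ ^ 8) ∧
    gOne (-1 / τ) = (fEta2 τ / 2 ^ 4 - gZero τ + gOne τ) / (2 * τ ^ 8) := by
  have h0 : τ ≠ 0 := by rintro rfl; simp at hτ
  have hsum : gZero τ + gOne τ = fEta2 (τ / 2) := by rw [gZero, gOne]; ring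
  have hdiff : gZero τ - gOne τ = fEta2 ((τ + 1) / 2) := by rw [gZero, gOne]; ring
  have h1 : fEta2 (-1 / τ / 2) = fEta2 τ / (2 ^ 4 * τ ^ 8) := by
    rw [← fEta2_neg_inv_two_mul hτ, div_div, mul_comm τ]
  have h2 : fEta2 ((-1 / τ + 1) / 2) = (gZero τ - gOne τ) / τ ^ 8 := by
    have h := fEta2_sub_one_div_two_mul_sub_one (s := (τ + 1) / 2) (by simpa using hτ)
    rw [show 2 * ((τ + 1) / 2) - 1 = τ by ring] at h
    rw [hdiff, ← h]
    congr 1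
    field_simp
    ring
  refine ⟨by rw [hsum, fEta2_neg_inv hτ], ?_, ?_⟩
  · rw [gZero, h1, h2]
    field_simp
    ring
  · rw [gOne, h1, h2]
    field_simp
    ring
end

section
/- More generally, for p prime with m = 8/(p+1) an integer (p ∈ {3,7}), set f(τ) = m·(η(2pτ)η(2τ))^m/(η(pτ)η(τ))^{2m} and γ(τ) = (η(pτ/2)η(τ/2))^m/(η(pτ)η(τ))^{2m}. Then δ(τ) = f(τ)+γ(τ) has an expansion in q^{1/2} containing only half-integral powers of q. -/
section

open Filter Topology Finset

/-- The finite product `∏_{k = 1}^{n} (1 - x ^ k)`. -/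
def eulerProd (x : ℂ) (n : ℕ) : ℂ := ∏ k ∈ range n, (1 - x ^ (k + 1))

/-- The infinite product `∏_{k ≥ 1} (1 - x ^ k)`. -/
noncomputable def eulerFun (x : ℂ) : ℂ := ∏' k : ℕ, (1 - x ^ (k + 1))

theorem one_sub_pow_ne_zero {x : ℂ} (hx : ‖x‖ < 1) (k : ℕ) : 1 - x ^ (k + 1) ≠ 0 := by
  intro h
  have h1 : ‖x ^ (k + 1)‖ = 1 := by rw [← sub_eq_zero.mp h, norm_one]
  rw [norm_pow] at h1
  exact (pow_lt_one₀ (norm_nonneg x) hx k.succ_ne_zero).ne h1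

theorem one_add_pow_ne_zero {x : ℂ} (hx : ‖x‖ < 1) (k : ℕ) : 1 + x ^ (k + 1) ≠ 0 := by
  intro h
  have h1 : ‖x ^ (k + 1)‖ = 1 := by
    rw [← norm_neg, ← eq_neg_of_add_eq_zero_left h, norm_one]
  rw [norm_pow] at h1
  exact (pow_lt_one₀ (norm_nonneg x) hx k.succ_ne_zero).ne h1

theorem norm_pow_lt_one {x : ℂ} (hx : ‖x‖ < 1) {k : ℕ} (hk : k ≠ 0) : ‖x ^ k‖ < 1 := by
  rw [norm_pow]
  exact pow_lt_one₀ (norm_nonneg x) hx hk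

theorem eulerProd_succ (x : ℂ) (n : ℕ) :
    eulerProd x (n + 1) = eulerProd x n * (1 - x ^ (n + 1)) :=
  prod_range_succ _ _

theorem eulerProd_ne_zero {x : ℂ} (hx : ‖x‖ < 1) (n : ℕ) : eulerProd x n ≠ 0 :=
  prod_ne_zero_iff.mpr fun k _ ↦ one_sub_pow_ne_zero hx k

theorem eulerFun_ne_zero {x : ℂ} (hx : ‖x‖ < 1) : eulerFun x ≠ 0 := by
  have hs : Summable fun n : ℕ ↦ ‖-x ^ (n + 1)‖ := by
    simp only [norm_neg, norm_pow]
    exact (summable_nat_add_iff (f := fun n : ℕ ↦ ‖x‖ ^ n) 1).mpr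
      (summable_geometric_of_lt_one (norm_nonneg x) hx)
  have h := tprod_one_add_ne_zero_of_summable
    (fun n ↦ by simpa [← sub_eq_add_neg] using one_sub_pow_ne_zero hx n) hs
  simpa [eulerFun, sub_eq_add_neg] using h

theorem tendsto_eulerProd {x : ℂ} (hx : ‖x‖ < 1) :
    Tendsto (eulerProd x) atTop (𝓝 (eulerFun x)) :=
  (ModularForm.multipliable_one_sub_pow hx).tendsto_prod_tprod_nat

theorem continuousAt_eulerFun_zero : ContinuousAt eulerFun 0 :=
  (ModularForm.differentiableOn_tprod_one_sub_pow.differentiableAt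
    (Metric.ball_mem_nhds 0 one_pos)).continuousAt

theorem eulerFun_zero : eulerFun 0 = 1 := by simp [eulerFun]

theorem exists_norm_div_le {u : ℕ → ℂ} {a : ℂ} (hu : Tendsto u atTop (𝓝 a)) (ha : a ≠ 0) :
    ∃ C : ℝ, 0 ≤ C ∧ ∀ n s, ‖u n / u s‖ ≤ C := by
  obtain ⟨A, hA⟩ := (Metric.isBounded_range_of_tendsto u hu).exists_norm_le
  obtain ⟨B, hB⟩ := (Metric.isBounded_range_of_tendsto _ (hu.inv₀ ha)).exists_norm_le
  have hA' (n : ℕ) : ‖u n‖ ≤ A := hA _ ⟨n, rfl⟩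
  have hB' (n : ℕ) : ‖(u n)⁻¹‖ ≤ B := hB _ ⟨n, rfl⟩
  have hA0 : 0 ≤ A := (norm_nonneg _).trans (hA' 0)
  have hB0 : 0 ≤ B := (norm_nonneg _).trans (hB' 0)
  refine ⟨A * B, by positivity, fun n s ↦ ?_⟩
  rw [div_eq_mul_inv, norm_mul]
  exact mul_le_mul (hA' n) (hB' s) (norm_nonneg _) hA0

theorem tendsto_sum_of_norm_le {c : ℕ → ℕ → ℂ} {C r : ℝ} {L : ℂ} (hr0 : 0 ≤ r) (hr1 : r < 1)
    (hc : ∀ n s, ‖c n (s + 1)‖ ≤ C * r ^ n) (h0 : Tendsto (fun n ↦ c n 0) atTop (𝓝 L)) :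
    Tendsto (fun n ↦ ∑ s ∈ range (n + 1), c n s) atTop (𝓝 L) := by
  simp_rw [sum_range_succ']
  rw [← zero_add L]
  refine Tendsto.add (squeeze_zero_norm (a := fun n : ℕ ↦ C * (n * r ^ n)) (fun n ↦ ?_) ?_) h0
  · refine (norm_sum_le_of_le _ fun s _ ↦ hc n s).trans (le_of_eq ?_)
    rw [sum_const, card_range, nsmul_eq_mul]
    ring
  · simpa using (tendsto_self_mul_const_pow_of_lt_one hr0 hr1).const_mul C

theorem norm_mul_pow_le {a x : ℂ} {C : ℝ} {k n : ℕ} (hx : ‖x‖ < 1) (ha : ‖a‖ ≤ C) (hkn : n ≤ k) :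
    ‖a * x ^ k‖ ≤ C * ‖x‖ ^ n := by
  rw [norm_mul, norm_pow]
  exact mul_le_mul ha (pow_le_pow_of_le_one (norm_nonneg _) hx.le hkn) (by positivity)
    ((norm_nonneg _).trans ha)

/-- The theta series with coefficients `w`. -/
noncomputable def thetaSeries (w : ℤ → ℤ) (t : ℂ) : ℂ := ∑' c : ℤ, (w c : ℂ) * t ^ (c.natAbs ^ 2)

theorem norm_intCast_le_one {a : ℤ} (ha : |a| ≤ 1) : ‖(a : ℂ)‖ ≤ 1 := by
  rw [Complex.norm_intCast]
  exact_mod_cast ha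

theorem summable_thetaSeries {w : ℤ → ℤ} (hw : ∀ c, |w c| ≤ 1) {t : ℂ} (ht : ‖t‖ < 1) :
    Summable fun c : ℤ ↦ ‖(w c : ℂ) * t ^ (c.natAbs ^ 2)‖ := by
  have hg : Summable fun n : ℕ ↦ ‖t‖ ^ n := summable_geometric_of_lt_one (norm_nonneg _) ht
  have hz : Summable fun c : ℤ ↦ ‖t‖ ^ c.natAbs :=
    Summable.of_nat_of_neg (by simpa using hg) (by simpa using hg)
  refine hz.of_nonneg_of_le (fun _ ↦ norm_nonneg _) fun c ↦ ?_
  simpa using norm_mul_pow_le ht (norm_intCast_le_one (hw c))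
    (Nat.le_self_pow two_ne_zero c.natAbs)

theorem thetaSeries_eq_of_tendsto {w : ℤ → ℤ} (hw : ∀ c, |w c| ≤ 1) (hw' : ∀ c, w (-c) = w c)
    {t L : ℂ} (ht : ‖t‖ < 1) {N : ℕ → ℕ} (hN : Tendsto N atTop atTop)
    (hL : Tendsto (fun n ↦ ∑ c ∈ range (N n), (w c : ℂ) * t ^ c ^ 2) atTop (𝓝 L)) :
    thetaSeries w t = 2 * L - w 0 := by
  have hs := (summable_thetaSeries hw ht).of_norm
  have h1 : HasSum (fun n : ℕ ↦ (w n : ℂ) * t ^ n ^ 2) L := by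
    have h2 : Summable fun n : ℕ ↦ (w n : ℂ) * t ^ n ^ 2 := by
      simpa [Function.comp_def] using hs.comp_injective Nat.cast_injective
    have h3 := h2.hasSum.tendsto_sum_nat.comp hN
    rw [tendsto_nhds_unique hL h3]
    exact h2.hasSum
  have h4 := HasSum.of_nat_of_neg (f := fun c : ℤ ↦ (w c : ℂ) * t ^ (c.natAbs ^ 2))
    (by simpa using h1) (by simpa [hw'] using h1)
  rw [thetaSeries, h4.tsum_eq]
  simp
  ring

theorem thetaSeries_mul {w v : ℤ → ℤ} (hw : ∀ c, |w c| ≤ 1) (hv : ∀ c, |v c| ≤ 1)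
    {t : ℂ} (ht : ‖t‖ < 1) {k : ℕ} (hk : k ≠ 0) :
    HasSum (fun p : ℤ × ℤ ↦
      (w p.1 * v p.2 : ℂ) * t ^ (p.1.natAbs ^ 2 + k * p.2.natAbs ^ 2))
      (thetaSeries w t * thetaSeries v (t ^ k)) := by
  let f : ℤ → ℂ := fun c ↦ (w c : ℂ) * t ^ (c.natAbs ^ 2)
  let g : ℤ → ℂ := fun c ↦ (v c : ℂ) * (t ^ k) ^ (c.natAbs ^ 2)
  have hf : Summable fun c ↦ ‖f c‖ := summable_thetaSeries hw ht
  have hg : Summable fun c ↦ ‖g c‖ := summable_thetaSeries hv (norm_pow_lt_one ht hk)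
  have hfg : HasSum (fun p : ℤ × ℤ ↦ f p.1 * g p.2) (thetaSeries w t * thetaSeries v (t ^ k)) :=
    HasSum.mul hf.of_norm.hasSum hg.of_norm.hasSum (summable_mul_of_summable_norm hf hg)
  have hterm (p : ℤ × ℤ) : f p.1 * g p.2 =
      (w p.1 * v p.2 : ℂ) * t ^ (p.1.natAbs ^ 2 + k * p.2.natAbs ^ 2) := by
    simp only [f, g]
    rw [pow_add, pow_mul]
    ring
  simpa only [hterm] using hfg

/-- The character modulo `12` with values `1, -1, -1, 1` at `1, 5, 7, 11`. -/
def chi (c : ℤ) : ℤ :=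
  if c % 12 = 1 ∨ c % 12 = 11 then 1 else if c % 12 = 5 ∨ c % 12 = 7 then -1 else 0

/-- The indicator function of the odd integers. -/
def oddInd (c : ℤ) : ℤ := if c % 2 = 1 then 1 else 0

/-- The function `c ↦ (-1) ^ c` on the integers. -/
def altSign (c : ℤ) : ℤ := if c % 2 = 1 then -1 else 1

theorem abs_chi_le (c : ℤ) : |chi c| ≤ 1 := by unfold chi; split_ifs <;> simp

theorem abs_oddInd_le (c : ℤ) : |oddInd c| ≤ 1 := by unfold oddInd; split_ifs <;> simp

theorem abs_altSign_le (c : ℤ) : |altSign c| ≤ 1 := by unfold altSign; split_ifs <;> simp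

theorem chi_neg (c : ℤ) : chi (-c) = chi c := by unfold chi; grind

theorem oddInd_neg (c : ℤ) : oddInd (-c) = oddInd c := by unfold oddInd; grind

theorem altSign_neg (c : ℤ) : altSign (-c) = altSign c := by unfold altSign; grind

theorem chi_six_mul_add_one (n : ℕ) : chi (6 * n + 1) = (-1) ^ n := by
  rcases n.even_or_odd' with ⟨m, rfl | rfl⟩ <;> simp [chi, pow_add, pow_mul] <;> grind

theorem chi_six_mul_add_five (n : ℕ) : chi (6 * n + 5) = -(-1) ^ n := by
  rcases n.even_or_odd' with ⟨m, rfl | rfl⟩ <;> simp [chi, pow_add, pow_mul] <;> grind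

theorem chi_eq_zero {c : ℤ} (h : c % 2 = 0 ∨ c % 3 = 0) : chi c = 0 := by
  unfold chi
  grind

theorem sum_altSign_eq {x : ℂ} (hx : ‖x‖ < 1) (n : ℕ) :
    2 * ∑ c ∈ range (n + 1), (altSign c : ℂ) * x ^ c ^ 2 - 1 =
      ∑ s ∈ range (n + 1), 2 * (-1) ^ s / (1 + x ^ s) *
        ((eulerProd x n ^ 2 / eulerProd (x ^ 2) n) /
          (eulerProd x s ^ 2 / eulerProd (x ^ 2) s)) * x ^ (s * (n + 1)) := by
  have hx' : ‖x ^ 2‖ < 1 := norm_pow_lt_one hx two_ne_zero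
  have hsucc (N : ℕ) : eulerProd x (N + 1) ^ 2 / eulerProd (x ^ 2) (N + 1) =
      eulerProd x N ^ 2 / eulerProd (x ^ 2) N * ((1 - x ^ (N + 1)) / (1 + x ^ (N + 1))) := by
    have h1 := one_sub_pow_ne_zero hx N
    have h2 := one_add_pow_ne_zero hx N
    have h3 := eulerProd_ne_zero hx' N
    rw [eulerProd_succ, eulerProd_succ, show 1 - (x ^ 2) ^ (N + 1) =
      (1 - x ^ (N + 1)) * (1 + x ^ (N + 1)) by ring]
    field_simp
  have hne (N : ℕ) : eulerProd x N ^ 2 / eulerProd (x ^ 2) N ≠ 0 :=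
    div_ne_zero (pow_ne_zero 2 (eulerProd_ne_zero hx N)) (eulerProd_ne_zero hx' N)
  have hzero : eulerProd x 0 ^ 2 / eulerProd (x ^ 2) 0 = 1 := by simp [eulerProd]
  induction n with
  | zero => 
    simp [altSign, eulerProd]
    norm_num
  | succ n ih =>
    have hstep (N : ℕ) : ∑ s ∈ range (N + 1),
        (2 * (-1) ^ s / (1 + x ^ s) *
        ((eulerProd x (n + 1) ^ 2 / eulerProd (x ^ 2) (n + 1)) /
          (eulerProd x s ^ 2 / eulerProd (x ^ 2) s)) * x ^ (s * (n + 1 + 1)) -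
        2 * (-1) ^ s / (1 + x ^ s) *
        ((eulerProd x n ^ 2 / eulerProd (x ^ 2) n) /
          (eulerProd x s ^ 2 / eulerProd (x ^ 2) s)) * x ^ (s * (n + 1))) =
        (eulerProd x n ^ 2 / eulerProd (x ^ 2) n) / (1 + x ^ (n + 1)) *
          (2 * (-1) ^ (N + 1) * x ^ ((N + 1) * (n + 1)) /
            (eulerProd x N ^ 2 / eulerProd (x ^ 2) N)) := by
      have h5 := one_sub_pow_ne_zero hx n
      have h6 := one_add_pow_ne_zero hx n
      have h7 := hne n
      induction N with
      | zero =>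
        simp only [zero_add, sum_range_one, hsucc n, hzero]
        generalize eulerProd x n ^ 2 / eulerProd (x ^ 2) n = Q at *
        norm_num
        field_simp
        ring
      | succ N ihN =>
        have h1 := hne N
        have h2 := one_sub_pow_ne_zero hx N
        have h3 := one_add_pow_ne_zero hx N
        rw [sum_range_succ, ihN, hsucc n, hsucc N]
        generalize eulerProd x n ^ 2 / eulerProd (x ^ 2) n = Q at *
        generalize eulerProd x N ^ 2 / eulerProd (x ^ 2) N = R at *
        field_simp
        ring
    have hend := hstep n
    rw [sum_sub_distrib, ← ih, sub_eq_iff_eq_add] at hend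
    have h1 := hne n
    have h2 := one_sub_pow_ne_zero hx n
    have h3 := one_add_pow_ne_zero hx n
    have hsign : (altSign ((n + 1 : ℕ) : ℤ) : ℂ) = (-1) ^ (n + 1) := by
      rcases n.even_or_odd' with ⟨m, rfl | rfl⟩ <;> (simp [altSign, pow_add, pow_mul]; try grind)
    rw [sum_range_succ _ (n + 1), sum_range_succ _ (n + 1), hend, hsign, hsucc n]
    generalize eulerProd x n ^ 2 / eulerProd (x ^ 2) n = Q at *
    field_simp
    ring

theorem thetaSeries_altSign {x : ℂ} (hx : ‖x‖ < 1) :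
    thetaSeries altSign x = eulerFun x ^ 2 / eulerFun (x ^ 2) := by
  have hx' : ‖x ^ 2‖ < 1 := norm_pow_lt_one hx two_ne_zero
  have htend : Tendsto (fun n ↦ eulerProd x n ^ 2 / eulerProd (x ^ 2) n) atTop
      (𝓝 (eulerFun x ^ 2 / eulerFun (x ^ 2))) :=
    ((tendsto_eulerProd hx).pow 2).div (tendsto_eulerProd hx') (eulerFun_ne_zero hx')
  obtain ⟨C, hC0, hC⟩ := exists_norm_div_le htend
    (div_ne_zero (pow_ne_zero 2 (eulerFun_ne_zero hx)) (eulerFun_ne_zero hx'))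
  have hsum := tendsto_sum_of_norm_le (L := eulerFun x ^ 2 / eulerFun (x ^ 2))
    (c := fun n s ↦ 2 * (-1) ^ s / (1 + x ^ s) * ((eulerProd x n ^ 2 / eulerProd (x ^ 2) n) /
      (eulerProd x s ^ 2 / eulerProd (x ^ 2) s)) * x ^ (s * (n + 1)))
    (norm_nonneg x) hx (C := 2 / (1 - ‖x‖) * C) (fun n s ↦ ?_) ?_
  · simp_rw [← sum_altSign_eq hx] at hsum
    rw [thetaSeries_eq_of_tendsto abs_altSign_le altSign_neg hx (N := fun n ↦ n + 1)
      (L := (eulerFun x ^ 2 / eulerFun (x ^ 2) + 1) / 2)]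
    · simp [altSign]
      ring
    · exact tendsto_add_atTop_nat 1
    · refine ((hsum.add_const 1).div_const 2).congr fun n ↦ ?_
      ring
  · refine norm_mul_pow_le hx ?_ (by nlinarith)
    rw [norm_mul]
    refine mul_le_mul ?_ (hC _ _) (norm_nonneg _) (by have := sub_pos.mpr hx; positivity)
    have h1 : 1 - ‖x‖ ≤ ‖1 + x ^ (s + 1)‖ := by
      have h2 := norm_sub_le_norm_add (1 : ℂ) (x ^ (s + 1))
      have h3 : ‖x ^ (s + 1)‖ ≤ ‖x‖ := by
        rw [norm_pow]
        exact pow_le_of_le_one (norm_nonneg _) hx.le s.succ_ne_zero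
      rw [norm_one] at h2
      linarith
    simpa using div_le_div_of_nonneg_left zero_le_two (sub_pos.mpr hx) h1
  · refine htend.congr fun n ↦ ?_
    simp [eulerProd]
    norm_num

theorem sum_chi_eq {t : ℂ} (ht : ‖t‖ < 1) (n : ℕ) :
    ∑ c ∈ range (6 * n + 2), (chi c : ℂ) * t ^ c ^ 2 =
      ∑ s ∈ range (n + 1), (-1) ^ s * (eulerProd (t ^ 24) n / eulerProd (t ^ 24) s) *
        t ^ (24 * s * n + 12 * s * (s + 1) + 1) := by
  have hx : ‖t ^ 24‖ < 1 := norm_pow_lt_one ht (by norm_num)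
  induction n with
  | zero => simp [sum_range_succ, chi, eulerProd]
  | succ n ih =>
    have hstep (N : ℕ) : ∑ s ∈ range N,
        ((-1) ^ s * (eulerProd (t ^ 24) (n + 1) / eulerProd (t ^ 24) s) *
          t ^ (24 * s * (n + 1) + 12 * s * (s + 1) + 1) -
        (-1) ^ s * (eulerProd (t ^ 24) n / eulerProd (t ^ 24) s) *
          t ^ (24 * s * n + 12 * s * (s + 1) + 1)) =
        eulerProd (t ^ 24) n * ((-1) ^ N * t ^ (24 * N * n + 12 * N * (N + 1) + 1) *
          (1 - (t ^ 24) ^ N) / eulerProd (t ^ 24) N) := by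
      induction N with
      | zero => simp
      | succ N ihN =>
        have h1 := eulerProd_ne_zero hx N
        have h2 := one_sub_pow_ne_zero hx N
        rw [sum_range_succ, ihN, eulerProd_succ, eulerProd_succ]
        field_simp
        ring
    have hend := hstep (n + 1)
    rw [sum_sub_distrib, ← ih, sub_eq_iff_eq_add] at hend
    have h1 := eulerProd_ne_zero hx n
    have h2 := one_sub_pow_ne_zero hx n
    rw [sum_range_succ _ (n + 1), hend, show 6 * (n + 1) + 2 = 6 * n + 2 + 6 by ring]
    have c2 : chi (6 * n + 2) = 0 := chi_eq_zero (by omega)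
    have c3 : chi (6 * n + 3) = 0 := chi_eq_zero (by omega)
    have c4 : chi (6 * n + 4) = 0 := chi_eq_zero (by omega)
    have c6 : chi (6 * n + 6) = 0 := chi_eq_zero (by omega)
    have c7 : chi (6 * n + 7) = -(-1) ^ n := by
      have := chi_six_mul_add_one (n + 1)
      push_cast at this
      rw [show (6 * n + 7 : ℤ) = 6 * (n + 1) + 1 by ring, this]
      ring
    rw [sum_range_add]
    generalize ∑ c ∈ range (6 * n + 2), (chi c : ℂ) * t ^ c ^ 2 = S
    simp only [sum_range_succ, range_zero, sum_empty, add_assoc]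
    push_cast
    norm_num [c2, c3, c4, chi_six_mul_add_five, c6, c7, eulerProd_succ]
    field_simp
    ring

theorem thetaSeries_chi {t : ℂ} (ht : ‖t‖ < 1) :
    thetaSeries chi t = 2 * t * eulerFun (t ^ 24) := by
  have hx : ‖t ^ 24‖ < 1 := norm_pow_lt_one ht (by norm_num)
  obtain ⟨C, hC0, hC⟩ := exists_norm_div_le (tendsto_eulerProd hx) (eulerFun_ne_zero hx)
  rw [thetaSeries_eq_of_tendsto abs_chi_le chi_neg ht (N := fun n ↦ 6 * n + 2)
    (L := t * eulerFun (t ^ 24))]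
  · simp [chi]
    ring
  · exact tendsto_atTop_mono (fun n ↦ by simp only [id]; omega) tendsto_id
  · simp_rw [sum_chi_eq ht]
    refine tendsto_sum_of_norm_le (norm_nonneg t) ht (C := C) (fun n s ↦ ?_) ?_
    · exact norm_mul_pow_le ht (by simpa using hC n (s + 1)) (by nlinarith)
    · simpa [eulerProd, mul_comm t] using (tendsto_eulerProd hx).mul_const t

theorem sum_oddInd_eq {t : ℂ} (ht : ‖t‖ < 1) (n : ℕ) :
    ∑ c ∈ range (4 * n + 4), (oddInd c : ℂ) * t ^ c ^ 2 =
      ∑ s ∈ range (n + 1), (eulerProd (t ^ 16) (n + 1) ^ 2 / eulerProd (t ^ 8) (2 * (n + 1))) /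
        (eulerProd (t ^ 16) s ^ 2 / eulerProd (t ^ 8) (2 * s)) * t ^ (8 * s * (2 * n + 3) + 1) := by
  have hx : ‖t ^ 8‖ < 1 := norm_pow_lt_one ht (by norm_num)
  have hx' : ‖t ^ 16‖ < 1 := norm_pow_lt_one ht (by norm_num)
  have hdouble (N : ℕ) : eulerProd (t ^ 8) (2 * (N + 1)) =
      eulerProd (t ^ 8) (2 * N) * (1 - t ^ (16 * N + 8)) * (1 - t ^ (16 * N + 16)) := by
    rw [mul_add, mul_one, eulerProd_succ, eulerProd_succ]
    ring
  have hsucc (N : ℕ) : eulerProd (t ^ 16) (N + 1) = 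
      eulerProd (t ^ 16) N * (1 - t ^ (16 * N + 16)) := by
    rw [eulerProd_succ]
    ring
  have hne8 (N : ℕ) : 1 - t ^ (16 * N + 8) ≠ 0 := one_sub_pow_ne_zero ht _
  have hne16 (N : ℕ) : 1 - t ^ (16 * N + 16) ≠ 0 := one_sub_pow_ne_zero ht _
  induction n with
  | zero =>
    have h1 := hne8 0
    have h2 := hne16 0
    simp [sum_range_succ, oddInd, eulerProd, prod_range_succ]
    field_simp
    ring
  | succ n ih =>
    have hstep (N : ℕ) : ∑ s ∈ range N,
        ((eulerProd (t ^ 16) (n + 1 + 1) ^ 2 / eulerProd (t ^ 8) (2 * (n + 1 + 1))) /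
        (eulerProd (t ^ 16) s ^ 2 / eulerProd (t ^ 8) (2 * s)) *
          t ^ (8 * s * (2 * (n + 1) + 3) + 1) - 
        (eulerProd (t ^ 16) (n + 1) ^ 2 / eulerProd (t ^ 8) (2 * (n + 1))) /
        (eulerProd (t ^ 16) s ^ 2 / eulerProd (t ^ 8) (2 * s)) * t ^ (8 * s * (2 * n + 3) + 1)) =
        (eulerProd (t ^ 16) (n + 1) ^ 2 / eulerProd (t ^ 8) (2 * (n + 1))) /
          (1 - t ^ (16 * (n + 1) + 8)) * (t ^ (8 * N * (2 * n + 3) + 1) * (1 - t ^ (16 * N)) /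
          (eulerProd (t ^ 16) N ^ 2 / eulerProd (t ^ 8) (2 * N))) := by
      induction N with
      | zero => simp
      | succ N ihN =>
        have h1 := eulerProd_ne_zero hx' N
        have h2 := eulerProd_ne_zero hx (2 * N)
        have h3 := eulerProd_ne_zero hx' (n + 1)
        have h4 := eulerProd_ne_zero hx (2 * (n + 1))
        have h5 := hne8 (n + 1)
        have h6 := hne16 (n + 1)
        have h7 := hne8 N
        have h8 := hne16 N
        rw [sum_range_succ, ihN, hsucc (n + 1), hdouble (n + 1), hsucc N, hdouble N]
        field_simp
        ring
    have hend := hstep (n + 1)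
    rw [sum_sub_distrib, ← ih, sub_eq_iff_eq_add] at hend
    have h3 := eulerProd_ne_zero hx' (n + 1)
    have h4 := eulerProd_ne_zero hx (2 * (n + 1))
    have h5 := hne8 (n + 1)
    have h6 := hne16 (n + 1)
    rw [sum_range_succ _ (n + 1), hend, show 4 * (n + 1) + 4 = 4 * n + 4 + 4 by ring]
    have c4 : oddInd (4 * n + 4) = 0 := by unfold oddInd; grind
    have c5 : oddInd (4 * n + 5) = 1 := by unfold oddInd; grind
    have c6 : oddInd (4 * n + 6) = 0 := by unfold oddInd; grind
    have c7 : oddInd (4 * n + 7) = 1 := by unfold oddInd; grind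
    rw [sum_range_add]
    generalize ∑ c ∈ range (4 * n + 4), (oddInd c : ℂ) * t ^ c ^ 2 = S
    simp only [sum_range_succ, range_zero, sum_empty, add_assoc]
    push_cast
    norm_num [c4, c5, c6, c7]
    rw [hsucc (n + 1), hdouble (n + 1)]
    field_simp
    ring

theorem thetaSeries_oddInd {t : ℂ} (ht : ‖t‖ < 1) :
    thetaSeries oddInd t = 2 * t * (eulerFun (t ^ 16) ^ 2 / eulerFun (t ^ 8)) := by
  have hx : ‖t ^ 8‖ < 1 := norm_pow_lt_one ht (by norm_num)
  have hx' : ‖t ^ 16‖ < 1 := norm_pow_lt_one ht (by norm_num)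
  have htend : Tendsto (fun n ↦ eulerProd (t ^ 16) n ^ 2 / eulerProd (t ^ 8) (2 * n)) atTop
      (𝓝 (eulerFun (t ^ 16) ^ 2 / eulerFun (t ^ 8))) :=
    ((tendsto_eulerProd hx').pow 2).div ((tendsto_eulerProd hx).comp
      (tendsto_atTop_mono (fun n ↦ by simp only [id]; omega) tendsto_id)) (eulerFun_ne_zero hx)
  obtain ⟨C, hC0, hC⟩ := exists_norm_div_le htend
    (div_ne_zero (pow_ne_zero 2 (eulerFun_ne_zero hx')) (eulerFun_ne_zero hx))
  rw [thetaSeries_eq_of_tendsto abs_oddInd_le oddInd_neg ht (N := fun n ↦ 4 * n + 4)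
    (L := t * (eulerFun (t ^ 16) ^ 2 / eulerFun (t ^ 8)))]
  · simp [oddInd]
    ring
  · exact tendsto_atTop_mono (fun n ↦ by simp only [id]; omega) tendsto_id
  · simp_rw [sum_oddInd_eq ht]
    refine tendsto_sum_of_norm_le (norm_nonneg t) ht (C := C) (fun n s ↦ ?_) ?_
    · exact norm_mul_pow_le ht (hC (n + 1) (s + 1)) (by nlinarith)
    · simpa [eulerProd, mul_comm t] using ((tendsto_add_atTop_iff_nat 1).mpr htend).mul_const t

theorem chi_emod (c : ℤ) : chi (c % 12) = chi c := by simp [chi]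

theorem chi_eq_chi {a b : ℤ} (h : a % 12 = b % 12) : chi a = chi b := by
  rw [← chi_emod a, h, chi_emod]

theorem chi_ne_zero {c : ℤ} (h : chi c ≠ 0) :
    c % 12 = 1 ∨ c % 12 = 5 ∨ c % 12 = 7 ∨ c % 12 = 11 := by
  unfold chi at h
  grind

theorem chi_mul_chi_of_odd {d : ℤ} (hd : d % 2 = 1) (k : ℤ) :
    chi (-5 * d - 6 * k) * chi (2 * k - d) = -(chi (d + 4 * k) * chi d) := by
  have key : ∀ d ∈ Finset.Ico (0 : ℤ) 12, ∀ k ∈ Finset.Ico (0 : ℤ) 12, d % 2 = 1 →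
      chi (-5 * d - 6 * k) * chi (2 * k - d) = -(chi (d + 4 * k) * chi d) := by decide
  have := key (d % 12) (by simp; omega) (k % 12) (by simp; omega) (by omega)
  rw [chi_eq_chi (a := -5 * (d % 12) - 6 * (k % 12)) (b := -5 * d - 6 * k) (by omega),
    chi_eq_chi (a := 2 * (k % 12) - d % 12) (b := 2 * k - d) (by omega),
    chi_eq_chi (a := d % 12 + 4 * (k % 12)) (b := d + 4 * k) (by omega), chi_emod] at this
  exact this

theorem chi_mul_chi_of_odd_of_odd {b j : ℤ} (hb : b % 2 = 1) (hj : j % 2 = 1) :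
    chi (j - 2 * b) * chi (2 * b + 3 * j) = -(chi (5 * b + 8 * j) * chi b) := by
  have key : ∀ b ∈ Finset.Ico (0 : ℤ) 12, ∀ j ∈ Finset.Ico (0 : ℤ) 12, b % 2 = 1 → j % 2 = 1 →
      chi (j - 2 * b) * chi (2 * b + 3 * j) = -(chi (5 * b + 8 * j) * chi b) := by decide
  have := key (b % 12) (by simp; omega) (j % 12) (by simp; omega) (by omega) (by omega)
  rw [chi_eq_chi (a := j % 12 - 2 * (b % 12)) (b := j - 2 * b) (by omega),
    chi_eq_chi (a := 2 * (b % 12) + 3 * (j % 12)) (b := 2 * b + 3 * j) (by omega),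
    chi_eq_chi (a := 5 * (b % 12) + 8 * (j % 12)) (b := 5 * b + 8 * j) (by omega),
    chi_emod] at this
  exact this

/-- The quadratic form `a ^ 2 + k * b ^ 2`. -/
def quadForm (k : ℕ) (p : ℤ × ℤ) : ℕ := p.1.natAbs ^ 2 + k * p.2.natAbs ^ 2

theorem natCast_quadForm (k : ℕ) (p : ℤ × ℤ) : (quadForm k p : ℤ) = p.1 ^ 2 + k * p.2 ^ 2 := by
  simp [quadForm]

/-- The general term of the product of the theta series of `chi` at `t` and `t ^ 7`. -/
def chiTerm (t : ℂ) (p : ℤ × ℤ) : ℂ := (chi p.1 * chi p.2 : ℂ) * t ^ quadForm 7 p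

theorem sq_emod_three {c : ℤ} (h : chi c ≠ 0) : c ^ 2 % 3 = 1 := by
  have : c % 3 = 1 ∨ c % 3 = 2 := by have := chi_ne_zero h; omega
  rcases this with h | h <;> simp [pow_two, Int.mul_emod, h]

theorem quadForm_emod {a b : ℤ} (ha : chi a ≠ 0) (hb : chi b ≠ 0) :
    quadForm 7 (a, b) % 48 = if (a - 5 * b) % 8 = 0 ∨ (a + 5 * b) % 8 = 0 then 32 else 8 := by
  have h3 : (a ^ 2 + 7 * b ^ 2) % 3 = 2 := by
    have := sq_emod_three ha
    have := sq_emod_three hb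
    omega
  have h16 : (a ^ 2 + 7 * b ^ 2) % 16 =
      if (a - 5 * b) % 8 = 0 ∨ (a + 5 * b) % 8 = 0 then 0 else 8 := by
    have ha' := chi_ne_zero ha
    have hb' := chi_ne_zero hb
    obtain ⟨i, r, rfl, hr⟩ : ∃ i r : ℤ, a = 8 * i + r ∧ (r = 1 ∨ r = 3 ∨ r = 5 ∨ r = 7) :=
      ⟨a / 8, a % 8, by omega, by omega⟩
    obtain ⟨j, s, rfl, hs⟩ : ∃ j s : ℤ, b = 8 * j + s ∧ (s = 1 ∨ s = 3 ∨ s = 5 ∨ s = 7) :=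
      ⟨b / 8, b % 8, by omega, by omega⟩
    rw [show (8 * i + r) ^ 2 + 7 * (8 * j + s) ^ 2 =
      16 * (4 * i ^ 2 + i * r + 28 * j ^ 2 + 7 * (j * s)) + (r ^ 2 + 7 * s ^ 2) by ring,
      Int.mul_add_emod_self_left]
    rcases hr with rfl | rfl | rfl | rfl <;> rcases hs with rfl | rfl | rfl | rfl <;>
      split_ifs <;> omega
  have hc := natCast_quadForm 7 (a, b)
  push_cast at hc
  split_ifs at h16 ⊢ <;> omega

/-- The involution of the lattice induced by multiplication by `(ρ / π) ^ 2` or its inverse, with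
`π` and `ρ` the prime factors of two in the ring of integers of `ℚ(√-7)`, acting on the elements
where this makes sense. -/
def twist (p : ℤ × ℤ) : ℤ × ℤ :=
  if p.2 % 2 = 1 ∧ (p.1 - 5 * p.2) % 16 = 8 then
    ((p.1 - 21 * p.2) / 8, (3 * p.1 + p.2) / 8)
  else if p.2 % 2 = 1 ∧ (p.1 + 5 * p.2) % 16 = 8 then
    ((p.1 + 21 * p.2) / 8, (p.2 - 3 * p.1) / 8)
  else p

theorem twist_involutive : Function.Involutive twist := by
  rintro ⟨a, b⟩
  unfold twist
  dsimp only
  split_ifs <;> first | rfl | (ext <;> dsimp only at * <;> omega)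

/-- Multiplication by the inverse of the square of a prime factor of two in the ring of integers
of `ℚ(√-7)`, up to normalization. -/
def dilate (p : ℤ × ℤ) : ℤ × ℤ :=
  if (p.1 - p.2) % 4 = 0 then ((-3 * p.1 - 7 * p.2) / 2, (p.1 - 3 * p.2) / 2)
  else ((-3 * p.1 + 7 * p.2) / 2, -((p.1 + 3 * p.2) / 2))

theorem tsum_chiTerm_twist (t : ℂ) :
    ∑' p : ℤ × ℤ, (if (p.1 - 5 * p.2) % 16 = 8 ∨ (p.1 + 5 * p.2) % 16 = 8 then chiTerm t p
      else 0) = 0 := by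
  set F : ℤ × ℤ → ℂ := fun p ↦
    if (p.1 - 5 * p.2) % 16 = 8 ∨ (p.1 + 5 * p.2) % 16 = 8 then chiTerm t p else 0 with hF
  have h1 : ∑' p, F (twist p) = ∑' p, F p := (twist_involutive.toPerm twist).tsum_eq F
  have h2 (p : ℤ × ℤ) : F (twist p) = -F p := by
    obtain ⟨a, b⟩ := p
    by_cases hb : b % 2 = 1
    · by_cases hP : (a - 5 * b) % 16 = 8
      · obtain ⟨j, rfl⟩ : ∃ j, a = 5 * b + 8 * j := ⟨(a - 5 * b) / 8, by omega⟩
        have hj : j % 2 = 1 := by omega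
        have ht : twist (5 * b + 8 * j, b) = (j - 2 * b, 2 * b + 3 * j) := by
          simp only [twist, hb, hP, and_self, if_true]
          ext <;> dsimp only <;> omega
        have hN : quadForm 7 (j - 2 * b, 2 * b + 3 * j) = quadForm 7 (5 * b + 8 * j, b) := by
          zify
          simp only [natCast_quadForm]
          push_cast
          ring
        have hs : (chi (j - 2 * b) * chi (2 * b + 3 * j) : ℂ) = -(chi (5 * b + 8 * j) * chi b) := by
          exact_mod_cast chi_mul_chi_of_odd_of_odd hb hj
        rw [ht]
        simp only [hF, chiTerm]
        rw [if_pos (Or.inr (by omega)), if_pos (Or.inl hP), hN, hs]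
        ring
      · by_cases hQ : (a + 5 * b) % 16 = 8
        · obtain ⟨j, rfl⟩ : ∃ j, a = -5 * b + 8 * j := ⟨(a + 5 * b) / 8, by omega⟩
          have hj : j % 2 = 1 := by omega
          have ht : twist (-5 * b + 8 * j, b) = (j + 2 * b, 2 * b - 3 * j) := by
            simp only [twist, hb, hP, hQ, and_self, and_false, if_true, if_false]
            ext <;> dsimp only <;> omega
          have hN : quadForm 7 (j + 2 * b, 2 * b - 3 * j) = quadForm 7 (-5 * b + 8 * j, b) := by
            zify
            simp only [natCast_quadForm]
            push_cast
            ring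
          have hs : (chi (j + 2 * b) * chi (2 * b - 3 * j) : ℂ) =
              -(chi (-5 * b + 8 * j) * chi b) := by
            have h := chi_mul_chi_of_odd_of_odd (b := -b) (j := j) (by omega) hj
            rw [← chi_neg (2 * -b + 3 * j), chi_neg b,
              show -(2 * -b + 3 * j) = 2 * b - 3 * j by ring,
              show j - 2 * -b = j + 2 * b by ring, show 5 * -b + 8 * j = -5 * b + 8 * j by ring] at h
            exact_mod_cast h
          rw [ht]
          simp only [hF, chiTerm]
          rw [if_pos (Or.inl (by omega)), if_pos (Or.inr hQ), hN, hs]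
          ring
        · have ht : twist (a, b) = (a, b) := by simp [twist, hP, hQ]
          simp [ht, hF, hP, hQ]
    · have ht : twist (a, b) = (a, b) := by simp [twist, hb]
      have hc : chi b = 0 := chi_eq_zero (by omega)
      simp [ht, hF, chiTerm, hc]
  simp only [h2, tsum_neg] at h1
  exact self_eq_neg.mp h1.symm

theorem quadForm_dilate {c d : ℤ} (hc : c % 2 = 1) (hd : d % 2 = 1) :
    quadForm 7 (dilate (c, d)) = 4 * quadForm 7 (c, d) := by
  zify
  simp only [natCast_quadForm, dilate]
  push_cast
  split_ifs with h
  · obtain ⟨k, rfl⟩ : ∃ k, c = d + 4 * k := ⟨(c - d) / 4, by omega⟩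
    rw [show (-3 * (d + 4 * k) - 7 * d) / 2 = -5 * d - 6 * k by omega,
      show (d + 4 * k - 3 * d) / 2 = 2 * k - d by omega]
    ring
  · obtain ⟨k, rfl⟩ : ∃ k, c = -d + 4 * k := ⟨(c + d) / 4, by omega⟩
    rw [show (-3 * (-d + 4 * k) + 7 * d) / 2 = 5 * d - 6 * k by omega,
      show (-d + 4 * k + 3 * d) / 2 = 2 * k + d by omega]
    ring

theorem chi_dilate {c d : ℤ} (hc : c % 2 = 1) (hd : d % 2 = 1) :
    chi (dilate (c, d)).1 * chi (dilate (c, d)).2 = -(chi c * chi d) := by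
  simp only [dilate]
  split_ifs with h
  · obtain ⟨k, rfl⟩ : ∃ k, c = d + 4 * k := ⟨(c - d) / 4, by omega⟩
    rw [show (-3 * (d + 4 * k) - 7 * d) / 2 = -5 * d - 6 * k by omega,
      show (d + 4 * k - 3 * d) / 2 = 2 * k - d by omega]
    exact chi_mul_chi_of_odd hd k
  · obtain ⟨k, rfl⟩ : ∃ k, c = -d + 4 * k := ⟨(c + d) / 4, by omega⟩
    rw [show (-3 * (-d + 4 * k) + 7 * d) / 2 = -5 * -d - 6 * k by omega,
      show (-d + 4 * k + 3 * d) / 2 = 2 * k - -d by omega, chi_neg, ← chi_neg d]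
    exact chi_mul_chi_of_odd (by omega) k

theorem tsum_chiTerm_dilate (t : ℂ) :
    ∑' p : ℤ × ℤ, (if (p.1 - 5 * p.2) % 16 = 0 ∨ (p.1 + 5 * p.2) % 16 = 0 then chiTerm t p
      else 0) = -∑' p : ℤ × ℤ, chiTerm (t ^ 4) p := by
  rw [← tsum_neg]
  have hodd {p : ℤ × ℤ} {t : ℂ} (hp : chiTerm t p ≠ 0) : p.1 % 2 = 1 ∧ p.2 % 2 = 1 := by
    have h1 : chi p.1 ≠ 0 := fun h ↦ hp (by simp [chiTerm, h])
    have h2 : chi p.2 ≠ 0 := fun h ↦ hp (by simp [chiTerm, h])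
    have := chi_ne_zero h1
    have := chi_ne_zero h2
    omega
  have hval {c d : ℤ} (hc : c % 2 = 1) (hd : d % 2 = 1) :
      chiTerm t (dilate (c, d)) = -chiTerm (t ^ 4) (c, d) := by
    have h : (chi (dilate (c, d)).1 * chi (dilate (c, d)).2 : ℂ) = -(chi c * chi d) := by
      exact_mod_cast chi_dilate hc hd
    rw [chiTerm, h, quadForm_dilate hc hd, chiTerm, pow_mul]
    ring
  refine tsum_eq_tsum_of_ne_zero_bij (fun p ↦ dilate p.1) ?_ ?_ ?_
  · rintro ⟨⟨c, d⟩, hp⟩ ⟨⟨c', d'⟩, hp'⟩ h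
    obtain ⟨h1, h2⟩ := hodd (neg_ne_zero.mp hp)
    obtain ⟨h1', h2'⟩ := hodd (neg_ne_zero.mp hp')
    simp only [dilate] at h
    dsimp only at h1 h2 h1' h2'
    simp only [Subtype.mk.injEq, Prod.mk.injEq]
    split_ifs at h <;> simp only [Prod.mk.injEq] at h <;> omega
  · rintro ⟨a, b⟩ hp
    simp only [Function.mem_support, ne_eq, ite_eq_right_iff, Classical.not_imp] at hp
    obtain ⟨hab, hne⟩ := hp
    obtain ⟨h1, h2⟩ := hodd hne
    dsimp only at hab h1 h2
    obtain ⟨c, d, hc, hd, h⟩ : ∃ c d, c % 2 = 1 ∧ d % 2 = 1 ∧ dilate (c, d) = (a, b) := by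
      rcases hab with hab | hab
      · refine ⟨(-3 * a + 7 * b) / 8, (-a - 3 * b) / 8, by omega, by omega, ?_⟩
        simp only [dilate]
        rw [if_pos (by omega)]
        ext <;> dsimp only <;> omega
      · refine ⟨(-3 * a - 7 * b) / 8, (a - 3 * b) / 8, by omega, by omega, ?_⟩
        simp only [dilate]
        rw [if_neg (by omega)]
        ext <;> dsimp only <;> omega
    refine ⟨⟨(c, d), ?_⟩, h⟩
    rw [Function.mem_support, ← hval hc hd, h]
    exact hne
  · rintro ⟨⟨c, d⟩, hp⟩
    obtain ⟨h1, h2⟩ := hodd (neg_ne_zero.mp hp)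
    dsimp only at h1 h2 ⊢
    rw [if_pos, hval h1 h2]
    simp only [dilate]
    split_ifs <;> dsimp only <;> omega

theorem chiTerm_sub {ζ : ℂ} (hζ : ζ ^ 24 = -1) (t : ℂ) (p : ℤ × ℤ) :
    ζ ^ 8 * chiTerm t p - chiTerm (ζ * t) p = 2 * ζ ^ 8 *
      ((if (p.1 - 5 * p.2) % 16 = 0 ∨ (p.1 + 5 * p.2) % 16 = 0 then chiTerm t p else 0) +
      (if (p.1 - 5 * p.2) % 16 = 8 ∨ (p.1 + 5 * p.2) % 16 = 8 then chiTerm t p else 0)) := by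
  obtain ⟨a, b⟩ := p
  by_cases ha : chi a = 0
  · simp [chiTerm, ha]
  by_cases hb : chi b = 0
  · simp [chiTerm, hb]
  have h48 : ζ ^ 48 = 1 := by rw [show 48 = 24 * 2 from rfl, pow_mul, hζ]; norm_num
  have hmul : chiTerm (ζ * t) (a, b) = ζ ^ (quadForm 7 (a, b) % 48) * chiTerm t (a, b) := by
    rw [← pow_eq_pow_mod _ h48, chiTerm, chiTerm, mul_pow]
    ring
  have h32 : ζ ^ 32 = -ζ ^ 8 := by
    rw [show 32 = 24 + 8 from rfl, pow_add, hζ]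
    ring
  have hb' := chi_ne_zero hb
  rw [hmul, quadForm_emod ha hb]
  dsimp only
  split_ifs <;> first | omega | (rw [h32]; ring) | ring

/-- The degree seven identity: the odd part of `∏ (1 - x ^ n) (1 - x ^ (7 * n))` is
`-x * ∏ (1 - x ^ (4 * n)) (1 - x ^ (28 * n))`. -/
theorem eulerFun_mul_seven {x : ℂ} (hx0 : x ≠ 0) (hx : ‖x‖ < 1) :
    eulerFun x * eulerFun (x ^ 7) - eulerFun (-x) * eulerFun ((-x) ^ 7) =
      -2 * x * (eulerFun (x ^ 4) * eulerFun (x ^ 28)) := by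
  obtain ⟨t, ht⟩ := IsAlgClosed.exists_pow_nat_eq x (show 0 < 24 by norm_num)
  obtain ⟨ζ, hζ⟩ := IsAlgClosed.exists_pow_nat_eq (-1 : ℂ) (show 0 < 24 by norm_num)
  have ht1 : ‖t‖ < 1 := by
    rw [← pow_lt_one_iff_of_nonneg (norm_nonneg t) (show 24 ≠ 0 by norm_num), ← norm_pow, ht]
    exact hx
  have hζ1 : ‖ζ‖ = 1 := by
    rw [← pow_eq_one_iff_of_nonneg (norm_nonneg ζ) (show 24 ≠ 0 by norm_num), ← norm_pow, hζ,
      norm_neg, norm_one]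
  have ht0 : t ≠ 0 := by
    rintro rfl
    exact hx0 (by rw [← ht]; norm_num)
  have hζ0 : ζ ≠ 0 := by
    rintro rfl
    norm_num at hζ1
  have hζt : ‖ζ * t‖ < 1 := by rwa [norm_mul, hζ1, one_mul]
  have hprod {s : ℂ} (hs : ‖s‖ < 1) :
      HasSum (chiTerm s) (4 * s ^ 8 * (eulerFun (s ^ 24) * eulerFun ((s ^ 24) ^ 7))) := by
    have h := thetaSeries_mul abs_chi_le abs_chi_le hs (k := 7) (by norm_num)
    rw [thetaSeries_chi hs, thetaSeries_chi (norm_pow_lt_one hs (by norm_num))] at h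
    refine (congrArg (HasSum (chiTerm s)) ?_).mp h
    rw [← pow_mul, ← pow_mul]
    ring
  have h4 := (hprod (norm_pow_lt_one ht1 (show 4 ≠ 0 by norm_num))).tsum_eq
  have hdiff := (((hprod ht1).mul_left (ζ ^ 8)).sub (hprod hζt)).tsum_eq
  simp_rw [chiTerm_sub hζ] at hdiff
  have hsum (q : ℤ × ℤ → Prop) [DecidablePred q] :
      Summable fun p ↦ if q p then chiTerm t p else 0 :=
    ((hprod ht1).summable.indicator {p | q p}).congr fun p ↦ by simp [Set.indicator_apply]
  rw [tsum_mul_left, (hsum fun p ↦ (p.1 - 5 * p.2) % 16 = 0 ∨ (p.1 + 5 * p.2) % 16 = 0).tsum_add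
      (hsum fun p ↦ (p.1 - 5 * p.2) % 16 = 8 ∨ (p.1 + 5 * p.2) % 16 = 8),
    tsum_chiTerm_dilate, tsum_chiTerm_twist, h4,
    mul_pow ζ t 24, hζ, ← pow_mul t 4 24, show 4 * 24 = 24 * 4 from rfl, pow_mul t 24 4, ht,
    mul_pow ζ t 8, neg_one_mul, ← pow_mul x 4 7, ← pow_mul t 4 8,
    show t ^ (4 * 8) = t ^ 8 * x by rw [← ht]; ring] at hdiff
  have hne : 4 * (ζ ^ 8 * t ^ 8) ≠ 0 := by simp [hζ0, ht0]
  apply mul_left_cancel₀ hne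
  norm_num at hdiff ⊢
  linear_combination -hdiff

theorem hasSum_quadForm_three {s L : ℂ} {ε : ℤ} (hε : ε = 1 ∨ ε = -1)
    (h : HasSum (fun p : ℤ × ℤ ↦ if (p.1 + p.2) % 2 = 1 then (s ^ 4) ^ quadForm 3 p else 0) L) :
    HasSum (fun p : ℤ × ℤ ↦ if p.1 % 2 = 1 ∧ p.2 % 2 = 1 ∧ (p.1 - ε * p.2) % 4 = 0 then
      s ^ quadForm 3 p else 0) L := by
  let i : ℤ × ℤ → ℤ × ℤ := fun p ↦ (p.1 - 3 * p.2, ε * (p.1 + p.2))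
  have hi : Function.Injective i := by
    rintro ⟨a, b⟩ ⟨a', b'⟩ hab
    simp only [i, Prod.mk.injEq] at hab ⊢
    rcases hε with rfl | rfl <;> omega
  rw [← hi.hasSum_iff]
  · convert h using 2 with p
    obtain ⟨a, b⟩ := p
    have hN : quadForm 3 (i (a, b)) = 4 * quadForm 3 (a, b) := by
      zify
      simp only [natCast_quadForm, i]
      push_cast
      rcases hε with rfl | rfl <;> ring
    simp only [Function.comp_apply, hN, pow_mul]
    congr 1
    simp only [i, eq_iff_iff]
    rcases hε with rfl | rfl <;> omega
  · rintro ⟨c, d⟩ hcd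
    refine if_neg fun h ↦ hcd ⟨((c + 3 * (ε * d)) / 4, (ε * d - c) / 4), ?_⟩
    simp only [i]
    dsimp only at h
    rcases hε with rfl | rfl <;> ext <;> dsimp only <;> omega

/-- The degree three identity: the odd part of `∏ (1 - x ^ n) ^ 2 (1 - x ^ (3 * n)) ^ 2` is
`-2 * x * ∏ (1 - x ^ (4 * n)) ^ 2 (1 - x ^ (12 * n)) ^ 2`. -/
theorem eulerFun_mul_three {x : ℂ} (hx : ‖x‖ < 1) :
    (eulerFun x * eulerFun (x ^ 3)) ^ 2 - (eulerFun (-x) * eulerFun ((-x) ^ 3)) ^ 2 =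
      -4 * x * (eulerFun (x ^ 4) * eulerFun (x ^ 12)) ^ 2 := by
  obtain ⟨s, hs⟩ := IsAlgClosed.exists_pow_nat_eq x (show 0 < 4 by norm_num)
  have hs1 : ‖s‖ < 1 := by
    rw [← pow_lt_one_iff_of_nonneg (norm_nonneg s) (show 4 ≠ 0 by norm_num), ← norm_pow, hs]
    exact hx
  have halt {y : ℂ} (hy : ‖y‖ < 1) := thetaSeries_mul abs_altSign_le abs_altSign_le hy
    (k := 3) (by norm_num)
  have hoddp := thetaSeries_mul abs_oddInd_le abs_oddInd_le hs1 (k := 3) (by norm_num)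
  have hx' : ‖-x‖ < 1 := by rwa [norm_neg]
  have hdiff := (halt hx').sub (halt hx)
  have hhalf : HasSum (fun p : ℤ × ℤ ↦ if (p.1 + p.2) % 2 = 1 then (s ^ 4) ^ quadForm 3 p else 0)
      ((thetaSeries altSign (-x) * thetaSeries altSign ((-x) ^ 3) -
        thetaSeries altSign x * thetaSeries altSign (x ^ 3)) / 2) := by
    refine (hdiff.div_const 2).congr_fun fun p ↦ ?_
    obtain ⟨a, b⟩ := p
    have hpar : (quadForm 3 (a, b) : ℤ) % 2 = (a + b) % 2 := by
      rw [natCast_quadForm]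
      rcases Int.emod_two_eq_zero_or_one a with ha | ha <;>
      rcases Int.emod_two_eq_zero_or_one b with hb | hb <;>
      simp [pow_two, Int.add_emod, Int.mul_emod, ha, hb]
    change _ = (_ * (-x) ^ quadForm 3 (a, b) - _ * x ^ quadForm 3 (a, b)) / 2
    rw [hs, neg_pow x]
    dsimp only
    have hsign : ((altSign a : ℂ) * altSign b) = (-1) ^ quadForm 3 (a, b) := by
      rcases (quadForm 3 (a, b)).even_or_odd with he | ho
      · rw [he.neg_one_pow]
        have := Nat.even_iff.mp he
        unfold altSign
        split_ifs <;> first | omega | norm_num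
      · rw [ho.neg_one_pow]
        have := Nat.odd_iff.mp ho
        unfold altSign
        split_ifs <;> first | omega | norm_num
    rw [hsign]
    rcases (quadForm 3 (a, b)).even_or_odd with he | ho
    · rw [he.neg_one_pow, if_neg (by have := Nat.even_iff.mp he; omega)]
      ring
    · rw [ho.neg_one_pow, if_pos (by have := Nat.odd_iff.mp ho; omega)]
      ring
  have hsplit := (hasSum_quadForm_three (Or.inl rfl) hhalf).add
    (hasSum_quadForm_three (Or.inr rfl) hhalf)
  have heq : thetaSeries oddInd s * thetaSeries oddInd (s ^ 3) =
      thetaSeries altSign (-x) * thetaSeries altSign ((-x) ^ 3) -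
        thetaSeries altSign x * thetaSeries altSign (x ^ 3) := by
    rw [← add_halves (thetaSeries altSign (-x) * thetaSeries altSign ((-x) ^ 3) -
        thetaSeries altSign x * thetaSeries altSign (x ^ 3))]
    refine hoddp.unique ?_
    refine hsplit.congr_fun fun p ↦ ?_
    obtain ⟨c, d⟩ := p
    change _ * s ^ quadForm 3 (c, d) = _
    unfold oddInd
    dsimp only
    split_ifs <;> first | omega | simp
  have hE (k : ℕ) (hk : k ≠ 0) : eulerFun (x ^ k) ≠ 0 := eulerFun_ne_zero (norm_pow_lt_one hx hk)
  have h2 := hE 2 (by norm_num)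
  have h6 := hE 6 (by norm_num)
  rw [thetaSeries_altSign hx, thetaSeries_altSign (norm_pow_lt_one hx (by norm_num)),
    thetaSeries_altSign hx', thetaSeries_altSign (norm_pow_lt_one hx' (by norm_num)),
    thetaSeries_oddInd hs1, thetaSeries_oddInd (norm_pow_lt_one hs1 (by norm_num)),
    show s ^ 16 = x ^ 4 by rw [← hs]; ring, show s ^ 8 = x ^ 2 by rw [← hs]; ring,
    show (s ^ 3) ^ 16 = x ^ 12 by rw [← hs]; ring, show (s ^ 3) ^ 8 = x ^ 6 by rw [← hs]; ring,
    show (x ^ 3) ^ 2 = x ^ 6 by ring, show ((-x) ^ 3) ^ 2 = x ^ 6 by ring, neg_sq,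
    show 2 * s * (eulerFun (x ^ 4) ^ 2 / eulerFun (x ^ 2)) *
      (2 * s ^ 3 * (eulerFun (x ^ 12) ^ 2 / eulerFun (x ^ 6))) = 4 * x *
      (eulerFun (x ^ 4) ^ 2 / eulerFun (x ^ 2) * (eulerFun (x ^ 12) ^ 2 / eulerFun (x ^ 6))) by
      rw [← hs]; ring] at heq
  rw [mul_pow, mul_pow, mul_pow, (show Odd 3 by decide).neg_pow x]
  field_simp at heq
  linear_combination heq

theorem eulerFun_mul_pow {p m : ℕ} (hp : p.Prime) (hm : (p + 1) * m = 8) {x : ℂ} (hx0 : x ≠ 0)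
    (hx : ‖x‖ < 1) :
    (eulerFun x * eulerFun (x ^ p)) ^ m - (eulerFun (-x) * eulerFun ((-x) ^ p)) ^ m =
      -(2 * m) * x * (eulerFun (x ^ 4) * eulerFun (x ^ (4 * p))) ^ m := by
  have hp7 : p ≤ 7 := by nlinarith [Nat.pos_of_ne_zero (show m ≠ 0 by rintro rfl; omega)]
  interval_cases p <;> try omega
  · exact absurd hp (by norm_num)
  · exact absurd hp (by norm_num)
  · obtain rfl : m = 2 := by omega
    linear_combination eulerFun_mul_three hx
  · obtain rfl : m = 1 := by omega
    linear_combination eulerFun_mul_seven hx0 hx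

theorem dedekindEta_mul_div_two (k : ℕ) (τ : ℂ) :
    dedekindEta (k * τ / 2) = Complex.exp (Real.pi * Complex.I * τ / 24) ^ k *
      eulerFun (Complex.exp (Real.pi * Complex.I * τ) ^ k) := by
  rw [dedekindEta, eulerFun, ← Complex.exp_nat_mul]
  congr 2
  · ring
  · funext n
    rw [← pow_mul, ← Complex.exp_nat_mul]
    congr 2
    push_cast
    ring

theorem dedekindEta_quotient_add {p m : ℕ} (hm : (p + 1) * m = 8) (τ : ℂ) {x : ℂ}
    (hx : Complex.exp (Real.pi * Complex.I * τ) = x) :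
    (m * (dedekindEta (2 * p * τ) * dedekindEta (2 * τ)) ^ m /
        (dedekindEta (p * τ) * dedekindEta τ) ^ (2 * m)) +
      ((dedekindEta (p * τ / 2) * dedekindEta (τ / 2)) ^ m /
        (dedekindEta (p * τ) * dedekindEta τ) ^ (2 * m)) =
      (m * x * (eulerFun (x ^ 4) * eulerFun (x ^ (4 * p))) ^ m +
        (eulerFun x * eulerFun (x ^ p)) ^ m) /
        (x * (eulerFun (x ^ 2) * eulerFun (x ^ (2 * p))) ^ (2 * m)) := by
  have hη (k : ℕ) (z : ℂ) (hz : z = k * τ / 2) := hz ▸ dedekindEta_mul_div_two k τ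
  have hy0 := Complex.exp_ne_zero (Real.pi * Complex.I * τ / 24)
  have hy : Complex.exp (Real.pi * Complex.I * τ / 24) ^ 24 = x := by
    rw [← hx, ← Complex.exp_nat_mul]
    congr 1
    push_cast
    ring
  rw [hη (4 * p) (2 * p * τ) (by push_cast; ring), hη 4 (2 * τ) (by push_cast; ring),
    hη (2 * p) (p * τ) (by push_cast; ring), hη 2 τ (by push_cast; ring), hη p (p * τ / 2) rfl,
    hη 1 (τ / 2) (by push_cast; ring), hx, pow_one x]
  generalize Complex.exp (Real.pi * Complex.I * τ / 24) = y at hy0 hy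
  have hpow (k : ℕ) (A B : ℂ) (n : ℕ) :
      (y ^ (k * p) * A * (y ^ k * B)) ^ (n * m) = y ^ (8 * (k * n)) * (B * A) ^ (n * m) := by
    rw [← hm]
    ring
  have h4 := hpow 4 (eulerFun (x ^ (4 * p))) (eulerFun (x ^ 4)) 1
  have h2 := hpow 2 (eulerFun (x ^ (2 * p))) (eulerFun (x ^ 2)) 2
  have h1 := hpow 1 (eulerFun (x ^ p)) (eulerFun x) 1
  rw [one_mul] at h4 h1
  rw [one_mul] at h1
  rw [h4, h2, h1, ← add_div]
  rw [show y ^ (8 * (4 * 1)) = y ^ 8 * x by rw [← hy]; ring,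
    mul_one, mul_one, mul_assoc (y ^ 8) x, mul_assoc (y ^ 8) x,
    ← mul_div_mul_left _ (x * _) (pow_ne_zero 8 hy0)]
  congr 1
  ring

theorem integral_exp_zpow (n : ℤ) :
    ∫ θ in (0 : ℝ)..2, Complex.exp (Real.pi * Complex.I * θ) ^ n =
      if n = 0 then 2 else 0 := by
  split_ifs with hn
  · simp [hn]
  · have hc : (n * (Real.pi * Complex.I) : ℂ) ≠ 0 := by simp [hn, Real.pi_ne_zero]
    simp_rw [← Complex.exp_int_mul, ← mul_assoc (n : ℂ)]
    rw [integral_exp_mul_complex (by simpa [mul_assoc] using hc)]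
    rw [show (n * Real.pi * Complex.I * ((2 : ℝ) : ℂ)) = n * (2 * Real.pi * Complex.I) by
      push_cast; ring, Complex.exp_int_mul_two_pi_mul_I]
    simp

theorem eq_zero_of_tsum_exp_eq_zero {c : ℤ → ℂ} (hc : Summable fun k ↦ ‖c k‖)
    (h : ∀ θ : ℝ, ∑' k, c k * Complex.exp (Real.pi * Complex.I * θ) ^ k = 0) (n : ℤ) :
    c n = 0 := by
  have hnorm (θ : ℝ) (k : ℤ) : ‖Complex.exp (Real.pi * Complex.I * θ) ^ k‖ = 1 := by
    simp [Complex.norm_exp]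
  have hI := intervalIntegral.hasSum_integral_of_dominated_convergence (μ := MeasureTheory.volume)
    (a := 0) (b := 2)
    (F := fun (k : ℤ) (θ : ℝ) ↦ c k * Complex.exp (Real.pi * Complex.I * θ) ^ (k - n))
    (f := fun _ ↦ 0) (fun k _ ↦ ‖c k‖)
    (fun k ↦ (Continuous.aestronglyMeasurable (by
      simp_rw [← Complex.exp_int_mul]
      fun_prop)))
    (fun k ↦ .of_forall fun θ _ ↦ by rw [norm_mul, hnorm, mul_one])
    (.of_forall fun θ _ ↦ hc)
    intervalIntegrable_const
    (.of_forall fun θ _ ↦ by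
      have hs : Summable fun k ↦ c k * Complex.exp (Real.pi * Complex.I * θ) ^ k :=
        Summable.of_norm (by simpa [norm_mul, hnorm] using hc)
      have := hs.hasSum.mul_right (Complex.exp (Real.pi * Complex.I * θ) ^ (-n))
      rw [h, zero_mul] at this
      refine this.congr_fun fun k ↦ ?_
      rw [sub_eq_add_neg, zpow_add₀ (Complex.exp_ne_zero _)]
      ring)
  simp only [intervalIntegral.integral_const_mul, integral_exp_zpow, sub_eq_zero, mul_ite,
    mul_zero, intervalIntegral.integral_zero] at hI
  have := hI.unique (hasSum_ite_eq n (c n * 2) |>.congr_fun fun k ↦ ?_)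
  · simpa using this.symm
  · split_ifs with hk
    · rw [hk]
    · rfl

theorem exists_norm_lt_one_ne_zero (m : ℕ) {p : ℕ} (hp : p ≠ 0) : ∃ x : ℂ, x ≠ 0 ∧ ‖x‖ < 1 ∧
    m * x * (eulerFun (x ^ 4) * eulerFun (x ^ (4 * p))) ^ m +
      (eulerFun x * eulerFun (x ^ p)) ^ m ≠ 0 := by
  have hE (k : ℕ) (hk : k ≠ 0) : ContinuousAt (fun x : ℂ ↦ eulerFun (x ^ k)) 0 :=
    ContinuousAt.comp (f := fun x : ℂ ↦ x ^ k) (g := eulerFun)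
      (by rw [zero_pow hk]; exact continuousAt_eulerFun_zero) (continuousAt_pow 0 k)
  have hcont : ContinuousAt (fun x : ℂ ↦ m * x * (eulerFun (x ^ 4) * eulerFun (x ^ (4 * p))) ^ m +
      (eulerFun x * eulerFun (x ^ p)) ^ m) 0 :=
    ((continuousAt_const.mul continuousAt_id).mul
      (((hE 4 (by norm_num)).mul (hE (4 * p) (by omega))).pow m)).add
      ((continuousAt_eulerFun_zero.mul (hE p hp)).pow m)
  have hne := hcont.eventually_ne (y := 0) (by simp [eulerFun_zero, hp])
  have hball : ∀ᶠ x : ℂ in 𝓝 0, ‖x‖ < 1 := continuousAt_id.norm.eventually_lt_const (by simp)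
  obtain ⟨x, hx0, hx⟩ := (eventually_mem_nhdsWithin.and
    (eventually_nhdsWithin_of_eventually_nhds (hball.and hne))).exists (f := 𝓝[≠] 0)
  exact ⟨x, hx0, hx⟩

theorem exists_exp_eq {x : ℂ} (hx0 : x ≠ 0) (hx : ‖x‖ < 1) :
    ∃ τ : ℂ, 0 < τ.im ∧ Complex.exp (Real.pi * Complex.I * τ) = x := by
  obtain ⟨τ, rfl⟩ : ∃ τ : ℂ, Complex.exp (Real.pi * Complex.I * τ) = x := by
    refine ⟨Complex.log x / (Real.pi * Complex.I), ?_⟩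
    rw [mul_div_cancel₀ _ (by simp [Real.pi_ne_zero]), Complex.exp_log hx0]
  refine ⟨τ, ?_, rfl⟩
  rw [Complex.norm_exp, Real.exp_lt_one_iff] at hx
  simpa [Real.pi_pos] using hx

end

/-- For `p` prime with `m = 8/(p+1)` an integer, with
`f(τ) = m(η(2pτ)η(2τ))^m/(η(pτ)η(τ))^{2m}` and
`γ(τ) = (η(pτ/2)η(τ/2))^m/(η(pτ)η(τ))^{2m}`, the expansion of `δ = f + γ` in powers of
`q^{1/2} = e^{πiτ}` contains only half-integral powers of `q`. -/
theorem stmt9 (p m : ℕ) (hp : p.Prime) (hm : (p + 1) * m = 8) (d : ℤ → ℂ)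
    (h : ∀ τ : ℂ, 0 < τ.im →
      (m * (dedekindEta (2 * p * τ) * dedekindEta (2 * τ)) ^ m /
          (dedekindEta (p * τ) * dedekindEta τ) ^ (2 * m)) +
        ((dedekindEta (p * τ / 2) * dedekindEta (τ / 2)) ^ m /
          (dedekindEta (p * τ) * dedekindEta τ) ^ (2 * m)) =
        ∑' k : ℤ, d k * Complex.exp (Real.pi * Complex.I * τ) ^ k) :
    ∀ n : ℤ, d (2 * n) = 0 := by
  let R (y : ℂ) : ℂ := (m * y * (eulerFun (y ^ 4) * eulerFun (y ^ (4 * p))) ^ m +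
    (eulerFun y * eulerFun (y ^ p)) ^ m) /
      (y * (eulerFun (y ^ 2) * eulerFun (y ^ (2 * p))) ^ (2 * m))
  have htsum {y : ℂ} (hy0 : y ≠ 0) (hy : ‖y‖ < 1) : ∑' k : ℤ, d k * y ^ k = R y := by
    obtain ⟨τ, him, hτ⟩ := exists_exp_eq hy0 hy
    rw [← hτ, ← h τ him, dedekindEta_quotient_add hm τ rfl]
  obtain ⟨x, hx0, hx, hH⟩ := exists_norm_lt_one_ne_zero m hp.ne_zero
  have hs : Summable fun k ↦ d k * x ^ k := by
    by_contra hs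
    refine div_ne_zero hH (mul_ne_zero hx0 (pow_ne_zero _ (mul_ne_zero ?_ ?_)))
      ((htsum hx0 hx).symm.trans (tsum_eq_zero_of_not_summable hs)) <;>
    exact eulerFun_ne_zero (norm_pow_lt_one hx (by have := hp.pos; omega))
  have hsum {y : ℂ} (hy : ‖y‖ = ‖x‖) : HasSum (fun k ↦ d k * y ^ k) (R y) := by
    rw [← htsum (by rwa [← norm_pos_iff, hy, norm_pos_iff]) (by rwa [hy])]
    exact (Summable.of_norm (by simpa [hy] using hs.norm)).hasSum
  have hadd {y : ℂ} (hy0 : y ≠ 0) (hy : ‖y‖ < 1) : R y + R (-y) = 0 := by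
    simp only [R, (show Even 4 by decide).neg_pow, (show Even (4 * p) by grind).neg_pow,
      (show Even (2 * p) by grind).neg_pow, neg_sq]
    rw [neg_mul y, div_neg, ← sub_eq_add_neg, ← sub_div, div_eq_zero_iff]
    left
    linear_combination eulerFun_mul_pow hp hm hy0 hy
  have hzero (θ : ℝ) : ∑' k : ℤ, d k * (1 + (-1) ^ k) * x ^ k *
      Complex.exp (Real.pi * Complex.I * θ) ^ k = 0 := by
    set y := x * Complex.exp (Real.pi * Complex.I * θ) with hy
    have hyx : ‖y‖ = ‖x‖ := by simp [hy, Complex.norm_exp]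
    have hy0 : y ≠ 0 := mul_ne_zero hx0 (Complex.exp_ne_zero _)
    rw [← hadd hy0 (by rwa [hyx]), ← ((hsum hyx).add (hsum ((norm_neg y).trans hyx))).tsum_eq]
    refine tsum_congr fun k ↦ ?_
    rw [neg_eq_neg_one_mul y, mul_zpow _ y, hy, mul_zpow x]
    ring
  have hnorm : Summable fun k : ℤ ↦ ‖d k * (1 + (-1) ^ k) * x ^ k‖ := by
    have hneg : Summable fun k : ℤ ↦ d k * (-x) ^ k := (hsum (norm_neg x)).summable
    refine (hs.add hneg).norm.congr fun k ↦ ?_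
    rw [neg_eq_neg_one_mul x, mul_zpow]
    ring_nf
  intro n
  have hn := eq_zero_of_tsum_exp_eq_zero hnorm hzero (2 * n)
  rw [(even_two_mul n).neg_one_zpow, mul_eq_zero, mul_eq_zero] at hn
  exact (hn.resolve_right (zpow_ne_zero _ hx0)).resolve_right (by norm_num)
end
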